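/- Let D be a nonempty finite set of points in ℝ² and k a positive integer. For θ ∈ [0, π/2] write w(θ) = (cos θ, sin θ), for t ∈ D let Θ_t = {θ ∈ [0, π/2] : rank_{w(θ)}(t) ≤ k}, and for t with Θ_t ≠ ∅ let I_t = [min Θ_t, max Θ_t]. Let c* be the minimum cardinality of a subset of D with rank-regret at most k (this exists since D itself qualifies). Let X ⊆ D be any subset of minimum cardinality among subsets Y ⊆ D with [0, π/2] ⊆ ⋃_{t ∈ Y, Θ_t ≠ ∅} I_t. Then |X| ≤ c* and X has rank-regret at most 2k, i.e., for every nonzero w ∈ ℝ² with nonnegative coordinates there exists t ∈ X with rank_w(t) ≤ 2k. (Algorithm-free combination of Theorems on 2DRRR: an optimal interval cover is no larger than the optimal rank-regret-k representative and guarantees rank-regret 2k.) -/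

import Mathlib

open scoped Classical

/-- Dot-product score of point `s` under weight vector `w`. -/
noncomputable def dotp {d : ℕ} (w s : Fin d → ℝ) : ℝ := ∑ i, w i * s i

/-- `rankOf D w t = 1 + |{s ∈ D : ⟨w,s⟩ > ⟨w,t⟩}|`. -/
noncomputable def rankOf {d : ℕ} (D : Finset (Fin d → ℝ)) (w t : Fin d → ℝ) : ℕ :=
  1 + (D.filter (fun s => dotp w s > dotp w t)).card

/-- The unit weight vector `(cos θ, sin θ)` in the plane. -/
noncomputable def wvec (θ : ℝ) : Fin 2 → ℝ := ![Real.cos θ, Real.sin θ]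

/-- The set of angles `θ ∈ [0, π/2]` for which `t` is in the top-`k` of `D` under `w(θ)`. -/
noncomputable def Theta (D : Finset (Fin 2 → ℝ)) (k : ℕ) (t : Fin 2 → ℝ) : Set ℝ :=
  {θ : ℝ | θ ∈ Set.Icc 0 (Real.pi / 2) ∧ rankOf D (wvec θ) t ≤ k}

/-- The interval `I_t = [min Θ_t, max Θ_t]` (meaningful when `Θ_t` is nonempty). -/
noncomputable def Ivl (D : Finset (Fin 2 → ℝ)) (k : ℕ) (t : Fin 2 → ℝ) : Set ℝ :=
  Set.Icc (sInf (Theta D k t)) (sSup (Theta D k t))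

/-- `X` has rank-regret at most `k` (nonnegative linear ranking functions, 2D). -/
noncomputable def HasRankRegretAtMost (D : Finset (Fin 2 → ℝ)) (k : ℕ)
    (X : Finset (Fin 2 → ℝ)) : Prop :=
  ∀ w : Fin 2 → ℝ, w ≠ 0 → (∀ i, 0 ≤ w i) → ∃ t ∈ X, rankOf D w t ≤ k

/-- The intervals of the members of `Y` cover the angle space `[0, π/2]`. -/
noncomputable def CoversAngles (D : Finset (Fin 2 → ℝ)) (k : ℕ)
    (Y : Finset (Fin 2 → ℝ)) : Prop :=
  Set.Icc 0 (Real.pi / 2) ⊆ ⋃ t ∈ Y, ⋃ (_ : (Theta D k t).Nonempty), Ivl D k t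

theorem dotp_wvec (θ : ℝ) (s : Fin 2 → ℝ) :
    dotp (wvec θ) s = Real.cos θ * s 0 + Real.sin θ * s 1 := by
  simp [dotp, wvec, Fin.sum_univ_two]

theorem wvec_ne_zero (θ : ℝ) : wvec θ ≠ 0 := by
  intro h
  have h0 : Real.cos θ = 0 := by simpa [wvec] using congrFun h 0
  have h1 : Real.sin θ = 0 := by simpa [wvec] using congrFun h 1
  have := Real.sin_sq_add_cos_sq θ
  rw [h0, h1] at this
  norm_num at this

theorem wvec_nonneg {θ : ℝ} (hθ : θ ∈ Set.Icc 0 (Real.pi / 2)) (i : Fin 2) : 0 ≤ wvec θ i := by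
  have hpi := Real.pi_pos
  fin_cases i
  · exact Real.cos_nonneg_of_mem_Icc ⟨by linarith [hθ.1], hθ.2⟩
  · exact Real.sin_nonneg_of_nonneg_of_le_pi hθ.1 (by linarith [hθ.2])

/-- Every nonzero nonnegative weight vector is a positive multiple of some `wvec θ`. -/
theorem exists_eq_smul_wvec {w : Fin 2 → ℝ} (hw : w ≠ 0) (hnn : ∀ i, 0 ≤ w i) :
    ∃ r : ℝ, 0 < r ∧ ∃ θ ∈ Set.Icc 0 (Real.pi / 2), w = r • wvec θ := by
  set z : ℂ := ⟨w 0, w 1⟩ with hz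
  have hz0 : z ≠ 0 := by
    intro h
    apply hw
    ext i
    fin_cases i
    · exact congrArg Complex.re h
    · exact congrArg Complex.im h
  refine ⟨‖z‖, norm_pos_iff.mpr hz0, z.arg, ⟨Complex.arg_nonneg_iff.mpr (hnn 1), ?_⟩, ?_⟩
  · exact (abs_le.mp (Complex.abs_arg_le_pi_div_two_iff.mpr (hnn 0))).2
  · ext i
    fin_cases i
    · exact (Complex.norm_mul_cos_arg z).symm
    · exact (Complex.norm_mul_sin_arg z).symm

theorem rankOf_smul {d : ℕ} (D : Finset (Fin d → ℝ)) {r : ℝ} (hr : 0 < r) (w t : Fin d → ℝ) :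
    rankOf D (r • w) t = rankOf D w t := by
  have h (s : Fin d → ℝ) : dotp (r • w) s = r * dotp w s := by
    simp [dotp, Finset.mul_sum, mul_assoc]
  simp only [rankOf, h, gt_iff_lt, mul_lt_mul_iff_right₀ hr]

theorem exists_rankOf_eq_one {d : ℕ} {D : Finset (Fin d → ℝ)} (hD : D.Nonempty)
    (w : Fin d → ℝ) : ∃ t ∈ D, rankOf D w t = 1 := by
  obtain ⟨t, ht, hmax⟩ := D.exists_max_image (dotp w) hD
  refine ⟨t, ht, ?_⟩
  simpa [rankOf, Finset.filter_eq_empty_iff] using hmax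

theorem isClosed_Theta (D : Finset (Fin 2 → ℝ)) (k : ℕ) (t : Fin 2 → ℝ) :
    IsClosed (Theta D k t) := by
  refine isClosed_Icc.inter (s₂ := {θ : ℝ | rankOf D (wvec θ) t ≤ k}) ?_
  rw [← isOpen_compl_iff, isOpen_iff_mem_nhds]
  intro θ hθ
  have hcont (s : Fin 2 → ℝ) : Continuous fun φ => dotp (wvec φ) s := by
    simp only [dotp_wvec]
    fun_prop
  have hev : ∀ᶠ φ in nhds θ, ∀ s ∈ D.filter (fun s => dotp (wvec θ) s > dotp (wvec θ) t),
      dotp (wvec φ) s > dotp (wvec φ) t := by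
    rw [Filter.eventually_all_finset]
    intro s hs
    exact (hcont t).continuousAt.eventually_lt (hcont s).continuousAt (Finset.mem_filter.mp hs).2
  filter_upwards [hev] with φ hφ
  have hle : rankOf D (wvec θ) t ≤ rankOf D (wvec φ) t := by
    refine Nat.add_le_add_left (Finset.card_le_card fun s hs => ?_) 1
    exact Finset.mem_filter.mpr ⟨(Finset.mem_filter.mp hs).1, hφ s hs⟩
  exact fun h => hθ (hle.trans h)

theorem bddBelow_Theta (D : Finset (Fin 2 → ℝ)) (k : ℕ) (t : Fin 2 → ℝ) :
    BddBelow (Theta D k t) :=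
  bddBelow_Icc.mono fun _ h => h.1

theorem bddAbove_Theta (D : Finset (Fin 2 → ℝ)) (k : ℕ) (t : Fin 2 → ℝ) :
    BddAbove (Theta D k t) :=
  bddAbove_Icc.mono fun _ h => h.1

/-- A point that outscores `t` at an intermediate angle does so at one of the two extremes. -/
theorem dotp_lt_or_dotp_lt_of_mem_Icc {α β θ : ℝ} (hθ : θ ∈ Set.Icc α β) (hαβ : β - α < Real.pi)
    {s t : Fin 2 → ℝ} (h : dotp (wvec θ) t < dotp (wvec θ) s) :
    dotp (wvec α) t < dotp (wvec α) s ∨ dotp (wvec β) t < dotp (wvec β) s := by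
  obtain ⟨h1, h2⟩ := hθ
  rcases h1.eq_or_lt with rfl | h1'
  · exact Or.inl h
  by_contra! hcon
  obtain ⟨ha, hb⟩ := hcon
  have hcomb (x : Fin 2 → ℝ) : Real.sin (β - α) * dotp (wvec θ) x =
      Real.sin (β - θ) * dotp (wvec α) x + Real.sin (θ - α) * dotp (wvec β) x := by
    simp only [dotp_wvec, Real.sin_sub]
    ring
  have hpos : 0 < Real.sin (β - α) := Real.sin_pos_of_pos_of_lt_pi (by linarith) hαβ
  have hβ : 0 ≤ Real.sin (β - θ) :=
    Real.sin_nonneg_of_nonneg_of_le_pi (by linarith) (by linarith)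
  have hα : 0 ≤ Real.sin (θ - α) :=
    Real.sin_nonneg_of_nonneg_of_le_pi (by linarith) (by linarith)
  have hs := mul_lt_mul_of_pos_left h hpos
  rw [hcomb, hcomb] at hs
  have := mul_le_mul_of_nonneg_left ha hβ
  have := mul_le_mul_of_nonneg_left hb hα
  linarith

theorem rankOf_wvec_add_one_le (D : Finset (Fin 2 → ℝ)) {α β θ : ℝ} (hθ : θ ∈ Set.Icc α β)
    (hαβ : β - α < Real.pi) (t : Fin 2 → ℝ) :
    rankOf D (wvec θ) t + 1 ≤ rankOf D (wvec α) t + rankOf D (wvec β) t := by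
  have hsub : D.filter (fun s => dotp (wvec θ) s > dotp (wvec θ) t) ⊆
      D.filter (fun s => dotp (wvec α) s > dotp (wvec α) t) ∪
      D.filter (fun s => dotp (wvec β) s > dotp (wvec β) t) := by
    rw [← Finset.filter_or]
    exact Finset.monotone_filter_right _ fun s _ h => dotp_lt_or_dotp_lt_of_mem_Icc hθ hαβ h
  have := (Finset.card_le_card hsub).trans (Finset.card_union_le _ _)
  unfold rankOf
  omega

theorem rankOf_le_two_mul_of_mem_Ivl {D : Finset (Fin 2 → ℝ)} {k : ℕ} {t : Fin 2 → ℝ}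
    (hne : (Theta D k t).Nonempty) {θ : ℝ} (hθ : θ ∈ Ivl D k t) :
    rankOf D (wvec θ) t ≤ 2 * k := by
  have hinf := (isClosed_Theta D k t).csInf_mem hne (bddBelow_Theta D k t)
  have hsup := (isClosed_Theta D k t).csSup_mem hne (bddAbove_Theta D k t)
  have hlt : sSup (Theta D k t) - sInf (Theta D k t) < Real.pi := by
    linarith [hinf.1.1, hsup.1.2, Real.pi_pos]
  have := rankOf_wvec_add_one_le D hθ hlt t
  have := hinf.2
  have := hsup.2
  omega

theorem HasRankRegretAtMost.coversAngles {D : Finset (Fin 2 → ℝ)} {k : ℕ}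
    {Y : Finset (Fin 2 → ℝ)} (hY : HasRankRegretAtMost D k Y) : CoversAngles D k Y := by
  intro θ hθ
  obtain ⟨t, ht, hr⟩ := hY (wvec θ) (wvec_ne_zero θ) (wvec_nonneg hθ)
  have hmem : θ ∈ Theta D k t := ⟨hθ, hr⟩
  simp only [Set.mem_iUnion]
  exact ⟨t, ht, ⟨θ, hmem⟩, csInf_le (bddBelow_Theta D k t) hmem,
    le_csSup (bddAbove_Theta D k t) hmem⟩

theorem CoversAngles.hasRankRegretAtMost_two_mul {D : Finset (Fin 2 → ℝ)} {k : ℕ}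
    {X : Finset (Fin 2 → ℝ)} (hX : CoversAngles D k X) : HasRankRegretAtMost D (2 * k) X := by
  intro w hw hnn
  obtain ⟨r, hr, θ, hθ, rfl⟩ := exists_eq_smul_wvec hw hnn
  have hcov := hX hθ
  simp only [Set.mem_iUnion] at hcov
  obtain ⟨t, ht, hne, hmem⟩ := hcov
  exact ⟨t, ht, (rankOf_smul D hr _ t).trans_le (rankOf_le_two_mul_of_mem_Ivl hne hmem)⟩

theorem stmt_15 (D : Finset (Fin 2 → ℝ)) (hD : D.Nonempty) (k : ℕ) (hk : 0 < k)
    (X : Finset (Fin 2 → ℝ)) (hX : X ⊆ D) (hXcov : CoversAngles D k X)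
    (hXmin : ∀ Y : Finset (Fin 2 → ℝ), Y ⊆ D → CoversAngles D k Y → X.card ≤ Y.card) :
    X.card ≤ sInf {n : ℕ | ∃ Y : Finset (Fin 2 → ℝ), Y ⊆ D ∧ Y.card = n ∧
        HasRankRegretAtMost D k Y} ∧
    HasRankRegretAtMost D (2 * k) X := by
  refine ⟨le_csInf ⟨D.card, D, subset_rfl, rfl, fun w _ _ => ?_⟩ ?_,
    hXcov.hasRankRegretAtMost_two_mul⟩
  · obtain ⟨t, ht, h1⟩ := exists_rankOf_eq_one hD w
    exact ⟨t, ht, h1.trans_le hk⟩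
  · rintro _ ⟨Y, hYD, rfl, hY⟩
    exact hXmin Y hYD hY.coversAngles
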